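/- Let m ∈ ℕ with m ≥ 1, let 1 ≤ p_1 < p_2 < ⋯ < p_m < ∞ be real numbers, and let Y = ℓ_{p_1} ⊕ ⋯ ⊕ ℓ_{p_m} ⊕ c₀ be the direct sum, normed by the maximum of the coordinate norms. Then for any strictly singular bounded linear operators T_1, …, T_{m+1} : Y → Y, the composition T_{m+1} ∘ T_m ∘ ⋯ ∘ T_1 is compact. -/

import Mathlib

open scoped ZeroAtInfty

/-- A bounded linear operator `T : E → F` between normed spaces is *strictly singular* if
for every infinite-dimensional subspace `M` of `E` and every `c > 0` there exists `x ∈ M`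
with `‖T x‖ < c * ‖x‖`. -/
def StrictlySingular {E F : Type*} [NormedAddCommGroup E] [NormedSpace ℝ E]
    [NormedAddCommGroup F] [NormedSpace ℝ F] (T : E →L[ℝ] F) : Prop :=
  ∀ M : Submodule ℝ E, ¬ FiniteDimensional ℝ M → ∀ c : ℝ, 0 < c → ∃ x ∈ M, ‖T x‖ < c * ‖x‖

section

open Filter Topology
open scoped ENNReal

section DisjointSupports

variable {p q : ℝ≥0∞}

theorem lp.norm_add_rpow_of_disjoint (hp : 0 < p.toReal) {x y : lp (fun _ : ℕ => ℝ) p}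
    (h : ∀ k, x k = 0 ∨ y k = 0) :
    ‖x + y‖ ^ p.toReal = ‖x‖ ^ p.toReal + ‖y‖ ^ p.toReal := by
  refine (lp.hasSum_norm hp (x + y)).unique ?_
  convert (lp.hasSum_norm hp x).add (lp.hasSum_norm hp y) using 2 with k
  rcases h k with h | h <;> simp [h, Real.zero_rpow hp.ne']

theorem lp.norm_le_norm_add_of_disjoint [Fact (1 ≤ p)] {x y : lp (fun _ : ℕ => ℝ) p}
    (h : ∀ k, x k = 0 ∨ y k = 0) : ‖x‖ ≤ ‖x + y‖ :=
  lp.norm_mono (zero_lt_one.trans_le (Fact.out : 1 ≤ p)).ne' fun k => by rcases h k with h | h <;> simp [h]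

theorem lp.norm_add_le_norm_add_of_disjoint [Fact (1 ≤ p)] [Fact (1 ≤ q)] (hqp : q ≤ p)
    {x y : lp (fun _ : ℕ => ℝ) p} {x' y' : lp (fun _ : ℕ => ℝ) q}
    (h : ∀ k, x k = 0 ∨ y k = 0) (h' : ∀ k, x' k = 0 ∨ y' k = 0)
    (hx : ‖x‖ ≤ ‖x'‖) (hy : ‖y‖ ≤ ‖y'‖) : ‖x + y‖ ≤ ‖x' + y'‖ := by
  have hp0 : p ≠ 0 := (zero_lt_one.trans_le (Fact.out : 1 ≤ p)).ne'
  have hq0 : q ≠ 0 := (zero_lt_one.trans_le (Fact.out : 1 ≤ q)).ne'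
  have hx' := hx.trans (lp.norm_le_norm_add_of_disjoint h')
  have hy' := hy.trans (lp.norm_le_norm_add_of_disjoint fun k => (h' k).symm)
  rw [add_comm y' x'] at hy'
  rcases eq_or_ne p ∞ with rfl | hp
  · refine lp.norm_le_of_forall_le (norm_nonneg _) fun k => ?_
    rcases h k with h | h
    · simpa [h] using (lp.norm_apply_le_norm hp0 y k).trans hy'
    · simpa [h] using (lp.norm_apply_le_norm hp0 x k).trans hx'
  · have hq : q ≠ ∞ := ne_top_of_le_ne_top hp hqp
    have hppos : 0 < p.toReal := ENNReal.toReal_pos hp0 hp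
    have hqpos : 0 < q.toReal := ENNReal.toReal_pos hq0 hq
    have key := Real.rpow_add_rpow_le (norm_nonneg x') (norm_nonneg y') hqpos
      (ENNReal.toReal_mono hp hqp)
    rw [← lp.norm_add_rpow_of_disjoint hqpos h', one_div, one_div,
      Real.rpow_rpow_inv (norm_nonneg _) hqpos.ne'] at key
    refine le_trans ?_ key
    rw [← Real.rpow_rpow_inv (norm_nonneg (x + y)) hppos.ne',
      lp.norm_add_rpow_of_disjoint hppos h]
    gcongr

theorem lp.norm_sum_le_norm_sum_of_disjoint [Fact (1 ≤ p)] [Fact (1 ≤ q)] (hqp : q ≤ p)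
    {ι : Type*} {b : ι → lp (fun _ : ℕ => ℝ) p} {d : ι → lp (fun _ : ℕ => ℝ) q}
    (hb : ∀ i j, i ≠ j → ∀ k, b i k = 0 ∨ b j k = 0)
    (hd : ∀ i j, i ≠ j → ∀ k, d i k = 0 ∨ d j k = 0)
    (h : ∀ i, ‖b i‖ ≤ ‖d i‖) (s : Finset ι) : ‖∑ i ∈ s, b i‖ ≤ ‖∑ i ∈ s, d i‖ := by
  classical
  induction s using Finset.induction_on with
  | empty => simp
  | insert i s his ih =>
    rw [Finset.sum_insert his, Finset.sum_insert his]
    have aux {r : ℝ≥0∞} {c : ι → lp (fun _ : ℕ => ℝ) r}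
        (hc : ∀ i j, i ≠ j → ∀ k, c i k = 0 ∨ c j k = 0) (k : ℕ) :
        c i k = 0 ∨ (∑ j ∈ s, c j : lp (fun _ : ℕ => ℝ) r) k = 0 := by
      refine or_iff_not_imp_left.2 fun hne => ?_
      rw [lp.coeFn_sum, Finset.sum_apply]
      refine Finset.sum_eq_zero fun j hj => (hc i j ?_ k).resolve_left hne
      rintro rfl
      exact his hj
    exact lp.norm_add_le_norm_add_of_disjoint hqp (aux hb) (aux hd) (h i) ih

theorem lp.norm_le_norm_sum_of_disjoint [Fact (1 ≤ p)] {ι : Type*}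
    {d : ι → lp (fun _ : ℕ => ℝ) p} (hd : ∀ i j, i ≠ j → ∀ k, d i k = 0 ∨ d j k = 0)
    {s : Finset ι} {i : ι} (hi : i ∈ s) : ‖d i‖ ≤ ‖∑ j ∈ s, d j‖ := by
  classical
  have := lp.norm_sum_le_norm_sum_of_disjoint le_rfl (b := fun j => if j = i then d j else 0)
    (d := d) (fun j l hjl k => ?_) hd (fun j => ?_) s
  · simpa [hi] using this
  · by_cases h : j = i
    · right; simp [show l ≠ i from fun h' => hjl (h.trans h'.symm)]
    · left; simp [h]
  · by_cases h : j = i <;> simp [h]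

end DisjointSupports

/-- The truncation of a sequence in `ℓ_p` to its first `N` coordinates. -/
noncomputable def lpTrunc {p : ℝ≥0∞} (N : ℕ) (x : lp (fun _ : ℕ => ℝ) p) :
    lp (fun _ : ℕ => ℝ) p :=
  ∑ i ∈ Finset.range N, lp.single p i (x i)

theorem lpTrunc_apply {p : ℝ≥0∞} (N : ℕ) (x : lp (fun _ : ℕ => ℝ) p) (k : ℕ) :
    lpTrunc N x k = if k < N then x k else 0 := by
  rw [lpTrunc, lp.coeFn_sum, Finset.sum_apply]
  simp

theorem tendsto_norm_lpTrunc_zero {p : ℝ≥0∞} [Fact (1 ≤ p)] {u : ℕ → lp (fun _ : ℕ => ℝ) p}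
    (hu : ∀ k, Tendsto (fun n => u n k) atTop (𝓝 0)) (N : ℕ) :
    Tendsto (fun n => ‖lpTrunc N (u n)‖) atTop (𝓝 0) := by
  have hsum : Tendsto (fun n => ∑ i ∈ Finset.range N, ‖u n i‖) atTop (𝓝 0) := by
    simpa using tendsto_finsetSum (Finset.range N) fun i _ => (hu i).norm
  refine squeeze_zero (fun _ => norm_nonneg _) (fun n => ?_) hsum
  refine (norm_sum_le _ _).trans_eq (Finset.sum_congr rfl fun i _ => ?_)
  exact lp.norm_single (zero_lt_one.trans_le Fact.out) i _

theorem exists_strictMono_gliding_hump {f g : ℕ → ℕ → ℝ}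
    (hf : ∀ N, Tendsto (fun n => f N n) atTop (𝓝 0))
    (hg : ∀ n, Tendsto (fun N => g N n) atTop (𝓝 0)) {ε : ℕ → ℝ} (hε : ∀ i, 0 < ε i) :
    ∃ φ N : ℕ → ℕ, StrictMono N ∧ ∀ i, f (N i) (φ i) < ε i ∧ g (N (i + 1)) (φ i) < ε i := by
  have h1 (i N : ℕ) : ∃ n, f N n < ε i := ((hf N).eventually_lt_const (hε i)).exists
  choose a ha using h1
  have h2 (i n N : ℕ) : ∃ N', N < N' ∧ g N' n < ε i :=
    ((eventually_gt_atTop N).and ((hg n).eventually_lt_const (hε i))).exists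
  choose b hb hb' using h2
  let N : ℕ → ℕ := fun i => Nat.rec 0 (fun i N => b i (a i N) N) i
  exact ⟨fun i => a i (N i), N, strictMono_nat_of_lt_succ fun i => hb _ _ _,
    fun i => ⟨ha _ _, hb' _ _ _⟩⟩

theorem lp.exists_linearCombination_le {p q : ℝ≥0∞} [Fact (1 ≤ p)] [Fact (1 ≤ q)] (hqp : q ≤ p)
    {u : ℕ → lp (fun _ : ℕ => ℝ) p} {v : ℕ → lp (fun _ : ℕ => ℝ) q} {C δ : ℝ}
    (huC : ∀ n, ‖u n‖ ≤ C) (hδ : 0 < δ) (hvδ : ∀ n, δ ≤ ‖v n‖)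
    (hu : ∀ k, Tendsto (fun n => u n k) atTop (𝓝 0))
    (hv : ∀ k, Tendsto (fun n => v n k) atTop (𝓝 0))
    (hut : ∀ n, Tendsto (fun N => ‖u n - lpTrunc N (u n)‖) atTop (𝓝 0))
    (hvt : ∀ n, Tendsto (fun N => ‖v n - lpTrunc N (v n)‖) atTop (𝓝 0)) :
    ∃ (φ : ℕ → ℕ) (K : ℝ), 0 < K ∧ ∀ a : ℕ →₀ ℝ,
      ‖Finsupp.linearCombination ℝ (u ∘ φ) a‖ ≤ K * ‖Finsupp.linearCombination ℝ (v ∘ φ) a‖ ∧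
      ∀ i, |a i| ≤ K * ‖Finsupp.linearCombination ℝ (v ∘ φ) a‖ := by
  have hC : 0 ≤ C := (norm_nonneg _).trans (huC 0)
  obtain ⟨ε, hε, c, hεc, hc⟩ := NNReal.exists_pos_sum_of_countable
    (ε := (δ / 8).toNNReal) (by simpa using hδ) ℕ
  replace hεc : HasSum (fun i => (ε i : ℝ)) c := by exact_mod_cast hεc
  replace hc : (c : ℝ) < δ / 8 := Real.lt_toNNReal_iff_coe_lt.1 hc
  have hεsum (s : Finset ℕ) : ∑ i ∈ s, (ε i : ℝ) ≤ δ / 8 :=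
    (sum_le_hasSum s (fun i _ => (ε i).2) hεc).trans hc.le
  have hεi (i : ℕ) : (ε i : ℝ) ≤ δ / 8 := by simpa using hεsum {i}
  obtain ⟨φ, N, hN, hφ⟩ := exists_strictMono_gliding_hump
    (f := fun N n => ‖lpTrunc N (u n)‖ + ‖lpTrunc N (v n)‖)
    (g := fun N n => ‖u n - lpTrunc N (u n)‖ + ‖v n - lpTrunc N (v n)‖)
    (fun N => by simpa using (tendsto_norm_lpTrunc_zero hu N).add (tendsto_norm_lpTrunc_zero hv N))
    (fun n => by simpa using (hut n).add (hvt n)) (ε := fun i => ε i) hε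
  let b : ℕ → lp (fun _ : ℕ => ℝ) p := fun i =>
    lpTrunc (N (i + 1)) (u (φ i)) - lpTrunc (N i) (u (φ i))
  let d : ℕ → lp (fun _ : ℕ => ℝ) q := fun i =>
    lpTrunc (N (i + 1)) (v (φ i)) - lpTrunc (N i) (v (φ i))
  have hblock {r : ℝ≥0∞} (w : ℕ → lp (fun _ : ℕ => ℝ) r) (i j : ℕ) (hij : i ≠ j) (k : ℕ) :
      (lpTrunc (N (i + 1)) (w i) - lpTrunc (N i) (w i)) k = 0 ∨
      (lpTrunc (N (j + 1)) (w j) - lpTrunc (N j) (w j)) k = 0 := by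
    have h1 := hN.monotone (Nat.le_succ i)
    have h2 := hN.monotone (Nat.le_succ j)
    simp only [lp.coeFn_sub, Pi.sub_apply, lpTrunc_apply]
    rcases lt_or_gt_of_ne hij with hlt | hlt
    all_goals
      have h3 := hN.monotone (Nat.succ_le_of_lt hlt)
      simp only [Nat.succ_eq_add_one] at h1 h2 h3
      split_ifs <;> first | (simp; done) | (exfalso; omega)
  have hdist {r : ℝ≥0∞} [Fact (1 ≤ r)] (w : ℕ → lp (fun _ : ℕ => ℝ) r) (i : ℕ)
      (h : ‖lpTrunc (N i) (w i)‖ ≤ ε i) (h' : ‖w i - lpTrunc (N (i + 1)) (w i)‖ ≤ ε i) :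
      ‖w i - (lpTrunc (N (i + 1)) (w i) - lpTrunc (N i) (w i))‖ ≤ 2 * ε i := by
    rw [← sub_add]
    linarith [norm_add_le (w i - lpTrunc (N (i + 1)) (w i)) (lpTrunc (N i) (w i))]
  have hub (i : ℕ) : ‖u (φ i) - b i‖ ≤ 2 * ε i :=
    hdist (u ∘ φ) i ((le_add_of_nonneg_right (norm_nonneg _)).trans (hφ i).1.le)
      ((le_add_of_nonneg_right (norm_nonneg _)).trans (hφ i).2.le)
  have hvd (i : ℕ) : ‖v (φ i) - d i‖ ≤ 2 * ε i :=
    hdist (v ∘ φ) i ((le_add_of_nonneg_left (norm_nonneg _)).trans (hφ i).1.le)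
      ((le_add_of_nonneg_left (norm_nonneg _)).trans (hφ i).2.le)
  have hd (i : ℕ) : δ / 2 ≤ ‖d i‖ := by
    linarith [hvd i, hεi i, hvδ (φ i), norm_sub_norm_le (v (φ i)) (d i)]
  have hb (i : ℕ) : ‖b i‖ ≤ C + δ / 4 := by
    linarith [hub i, hεi i, huC (φ i), norm_sub_norm_le (b i) (u (φ i)),
      norm_sub_rev (b i) (u (φ i))]
  set K : ℝ := (C + δ / 4) / (δ / 2) with hK
  have hK0 : 0 ≤ K := by positivity
  have hbd (i : ℕ) : ‖b i‖ ≤ K * ‖d i‖ := by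
    refine (hb i).trans ?_
    rw [hK, div_mul_eq_mul_div, le_div_iff₀ (by positivity)]
    exact mul_le_mul_of_nonneg_left (hd i) (by positivity)
  refine ⟨φ, 2 * K + 1 + 4 / δ, by positivity, fun a => ?_⟩
  simp only [Finsupp.linearCombination_apply, Finsupp.sum, Function.comp_apply]
  set D : ℝ := ‖∑ i ∈ a.support, a i • d i‖ with hD
  have hsmul {r : ℝ≥0∞} {w : ℕ → lp (fun _ : ℕ => ℝ) r}
      (hw : ∀ i j, i ≠ j → ∀ k, w i k = 0 ∨ w j k = 0) (i j : ℕ) (hij : i ≠ j) (k : ℕ) :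
      (a i • w i) k = 0 ∨ (a j • w j) k = 0 := by
    simp only [lp.coeFn_smul, Pi.smul_apply]
    exact (hw i j hij k).imp (fun h => by simp [h]) fun h => by simp [h]
  have had (i : ℕ) : |a i| ≤ 2 / δ * D := by
    by_cases hi : i ∈ a.support
    · have h := lp.norm_le_norm_sum_of_disjoint (hsmul (hblock (v ∘ φ))) hi
      change ‖a i • d i‖ ≤ D at h
      rw [norm_smul, Real.norm_eq_abs] at h
      rw [div_mul_eq_mul_div, le_div_iff₀ hδ]
      nlinarith [mul_le_mul_of_nonneg_left (hd i) (abs_nonneg (a i))]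
    · rw [Finsupp.notMem_support_iff.1 hi, abs_zero]
      positivity
  have hpert {r : ℝ≥0∞} [Fact (1 ≤ r)] {w w' : ℕ → lp (fun _ : ℕ => ℝ) r}
      (hw : ∀ i, ‖w i - w' i‖ ≤ 2 * ε i) :
      ‖∑ i ∈ a.support, a i • w i - ∑ i ∈ a.support, a i • w' i‖ ≤ D / 2 := by
    rw [← Finset.sum_sub_distrib]
    calc ‖∑ i ∈ a.support, (a i • w i - a i • w' i)‖
        ≤ ∑ i ∈ a.support, 4 / δ * D * ε i := norm_sum_le_of_le _ fun i _ => by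
          rw [← smul_sub, norm_smul, Real.norm_eq_abs]
          calc |a i| * ‖w i - w' i‖ ≤ 2 / δ * D * (2 * ε i) :=
                mul_le_mul (had i) (hw i) (norm_nonneg _) (by positivity)
            _ = 4 / δ * D * ε i := by ring
      _ ≤ 4 / δ * D * (δ / 8) := by
          rw [← Finset.mul_sum]
          exact mul_le_mul_of_nonneg_left (hεsum _) (by positivity)
      _ = D / 2 := by field_simp; ring
  have hV : D ≤ 2 * ‖∑ i ∈ a.support, a i • v (φ i)‖ := by
    have h := norm_sub_norm_le (∑ i ∈ a.support, a i • d i) (∑ i ∈ a.support, a i • v (φ i))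
    rw [norm_sub_rev] at h
    linarith [hpert hvd]
  have hB : ‖∑ i ∈ a.support, a i • b i‖ ≤ K * D := by
    have h := lp.norm_sum_le_norm_sum_of_disjoint hqp (b := fun i => a i • b i)
      (d := fun i => K • a i • d i) (hsmul (hblock (u ∘ φ)))
      (fun i j hij k => (hsmul (hblock (v ∘ φ)) i j hij k).imp
        (fun h => by rw [lp.coeFn_smul, Pi.smul_apply]; exact smul_eq_zero_of_right _ h)
        (fun h => by rw [lp.coeFn_smul, Pi.smul_apply]; exact smul_eq_zero_of_right _ h))
      (fun i => by
        rw [norm_smul, norm_smul, norm_smul, Real.norm_of_nonneg hK0, mul_left_comm]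
        exact mul_le_mul_of_nonneg_left (hbd i) (norm_nonneg _)) a.support
    rwa [← Finset.smul_sum, norm_smul, Real.norm_of_nonneg hK0] at h
  have hU := norm_sub_norm_le (∑ i ∈ a.support, a i • u (φ i)) (∑ i ∈ a.support, a i • b i)
  have hpu := hpert hub
  set W := ‖∑ i ∈ a.support, a i • v (φ i)‖
  have hKD : K * D ≤ K * (2 * W) := mul_le_mul_of_nonneg_left hV hK0
  have hδD : 2 / δ * D ≤ 2 / δ * (2 * W) := mul_le_mul_of_nonneg_left hV (by positivity)
  have hW : 0 ≤ W := norm_nonneg _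
  have hδW : 0 ≤ 4 / δ * W := by positivity
  have hKW : 0 ≤ K * W := by positivity
  have e : 2 / δ * (2 * W) = 4 / δ * W := by ring
  refine ⟨by linarith, fun i => ?_⟩
  linarith [had i]

theorem lp.exists_strictMono_tendsto_apply {p : ℝ≥0∞} [Fact (1 ≤ p)]
    {w : ℕ → lp (fun _ : ℕ => ℝ) p} {C : ℝ} (hw : ∀ n, ‖w n‖ ≤ C) :
    ∃ φ : ℕ → ℕ, StrictMono φ ∧ ∃ l : ℕ → ℝ, ∀ k, Tendsto (fun n => w (φ n) k) atTop (𝓝 (l k)) := by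
  have hcomp : IsCompact (Set.univ.pi fun _ : ℕ => Set.Icc (-C) C) :=
    isCompact_univ_pi fun _ => isCompact_Icc
  obtain ⟨l, -, φ, hφ, h⟩ := hcomp.tendsto_subseq (x := fun n k => w n k) fun n k _ =>
    abs_le.1 ((lp.norm_apply_le_norm (zero_lt_one.trans_le (Fact.out : 1 ≤ p)).ne' _ k).trans (hw n))
  exact ⟨φ, hφ, l, tendsto_pi_nhds.1 h⟩

theorem ContinuousLinearMap.exists_seq_le_norm_sub_of_not_isCompactOperator {X Z : Type*}
    [NormedAddCommGroup X] [NormedSpace ℝ X] [NormedAddCommGroup Z] [NormedSpace ℝ Z]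
    [CompleteSpace Z] {T : X →L[ℝ] Z} (hT : ¬ IsCompactOperator T) :
    ∃ (δ : ℝ) (x : ℕ → X), 0 < δ ∧ (∀ n, ‖x n‖ ≤ 1) ∧
      Pairwise fun m n => δ ≤ ‖T (x m) - T (x n)‖ := by
  have hT' : ¬ TotallyBounded (T '' Metric.closedBall 0 1) := fun h => hT <|
    (isCompactOperator_iff_isCompact_closure_image_closedBall T.toLinearMap zero_lt_one).2
      (h.closure.isCompact_of_isClosed isClosed_closure)
  rw [Metric.totallyBounded_iff] at hT'
  push Not at hT'
  obtain ⟨δ, hδ, h⟩ := hT'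
  have : Std.Symm fun x y : X => δ ≤ ‖T x - T y‖ := ⟨fun x y hxy => by rwa [norm_sub_rev]⟩
  obtain ⟨x, hx, hx'⟩ := exists_seq_of_forall_finset_exists' (fun x : X => ‖x‖ ≤ 1)
    (fun x y => δ ≤ ‖T x - T y‖) fun s _ => by
      obtain ⟨z, ⟨y, hy, rfl⟩, hz⟩ := Set.not_subset.1 (h (T '' s) (s.finite_toSet.image T))
      refine ⟨y, by simpa using hy, fun x hx => ?_⟩
      simp only [Set.mem_iUnion, not_exists] at hz
      simpa [dist_eq_norm, norm_sub_rev] using hz (T x) (Set.mem_image_of_mem T hx)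
  exact ⟨δ, x, hδ, hx, hx'⟩

section StrictlySingular

variable {X Z W : Type*} [NormedAddCommGroup X] [NormedSpace ℝ X] [NormedAddCommGroup Z]
  [NormedSpace ℝ Z] [NormedAddCommGroup W] [NormedSpace ℝ W]

theorem StrictlySingular.clm_comp {T : X →L[ℝ] Z} (hT : StrictlySingular T) (S : Z →L[ℝ] W) :
    StrictlySingular (S ∘L T) := by
  intro M hM c hc
  obtain ⟨x, hx, h⟩ := hT M hM (c / (‖S‖ + 1)) (by positivity)
  refine ⟨x, hx, (S.le_opNorm (T x)).trans_lt ?_⟩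
  rw [div_mul_eq_mul_div, lt_div_iff₀ (by positivity)] at h
  nlinarith [norm_nonneg (T x), norm_nonneg S, S.le_opNorm (T x)]

theorem StrictlySingular.comp_isometry {T : X →L[ℝ] Z} (hT : StrictlySingular T)
    (S : W →L[ℝ] X) (hS : ∀ x, ‖S x‖ = ‖x‖) : StrictlySingular (T ∘L S) := by
  intro M hM c hc
  have hinj : Function.Injective S.toLinearMap :=
    (injective_iff_map_eq_zero S.toLinearMap).2 fun x hx => by
      rw [← norm_eq_zero, ← hS]; exact norm_eq_zero.2 hx
  have hM' : ¬ FiniteDimensional ℝ (M.map S.toLinearMap) := fun h =>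
    hM (Module.Finite.equiv (M.equivMapOfInjective S.toLinearMap hinj).symm)
  obtain ⟨_, ⟨x, hx, rfl⟩, h⟩ := hT _ hM' c hc
  exact ⟨x, hx, by simpa [hS] using h⟩

theorem StrictlySingular.isCompactOperator_of_linearIsometry_lp [CompleteSpace Z]
    {p q : ℝ≥0∞} [Fact (1 ≤ p)] [Fact (1 ≤ q)] (hqp : q ≤ p)
    (I : X →ₗᵢ[ℝ] lp (fun _ : ℕ => ℝ) p) (J : Z →ₗᵢ[ℝ] lp (fun _ : ℕ => ℝ) q)
    (hI : ∀ x, Tendsto (fun N => ‖I x - lpTrunc N (I x)‖) atTop (𝓝 0))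
    (hJ : ∀ z, Tendsto (fun N => ‖J z - lpTrunc N (J z)‖) atTop (𝓝 0))
    {T : X →L[ℝ] Z} (hT : StrictlySingular T) : IsCompactOperator T := by
  by_contra hcomp
  obtain ⟨δ, x, hδ, hx, hTx⟩ :=
    ContinuousLinearMap.exists_seq_le_norm_sub_of_not_isCompactOperator hcomp
  obtain ⟨φ, hφ, l, hl⟩ := lp.exists_strictMono_tendsto_apply (w := fun n => I (x n)) (C := 1)
    fun n => by simpa using hx n
  obtain ⟨ψ, hψ, l', hl'⟩ := lp.exists_strictMono_tendsto_apply
    (w := fun n => J (T (x (φ n)))) (C := ‖T‖) fun n => by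
      simpa using T.le_of_opNorm_le_of_le le_rfl (hx (φ n))
  have hθ : StrictMono (φ ∘ ψ) := hφ.comp hψ
  let y : ℕ → X := fun n => x ((φ ∘ ψ) (n + 1)) - x ((φ ∘ ψ) n)
  have hy (k : ℕ) : Tendsto (fun n => I (y n) k) atTop (𝓝 0) := by
    have h := (hl k).comp hψ.tendsto_atTop
    simpa [y, Function.comp_def] using (h.comp (tendsto_add_atTop_nat 1)).sub h
  have hTy (k : ℕ) : Tendsto (fun n => J (T (y n)) k) atTop (𝓝 0) := by
    simpa [y, Function.comp_def] using ((hl' k).comp (tendsto_add_atTop_nat 1)).sub (hl' k)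
  obtain ⟨τ, K, hK, h⟩ := lp.exists_linearCombination_le hqp (u := fun n => I (y n))
    (v := fun n => J (T (y n))) (C := 2) (δ := δ)
    (fun n => by
      rw [I.norm_map]
      exact (norm_sub_le _ _).trans (by linarith [hx ((φ ∘ ψ) (n + 1)), hx ((φ ∘ ψ) n)]))
    hδ (fun n => by
      rw [J.norm_map, map_sub]
      exact hTx (hθ n.lt_succ_self).ne')
    hy hTy (fun n => hI _) (fun n => hJ _)
  let L : (ℕ →₀ ℝ) →ₗ[ℝ] X := Finsupp.linearCombination ℝ (y ∘ τ)
  have hIL (a : ℕ →₀ ℝ) : Finsupp.linearCombination ℝ ((fun n => I (y n)) ∘ τ) a = I (L a) :=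
    (Finsupp.apply_linearCombination ℝ I.toLinearMap (y ∘ τ) a).symm
  have hJL (a : ℕ →₀ ℝ) :
      Finsupp.linearCombination ℝ ((fun n => J (T (y n))) ∘ τ) a = J (T (L a)) :=
    (Finsupp.apply_linearCombination ℝ (J.toLinearMap ∘ₗ T.toLinearMap) (y ∘ τ) a).symm
  simp only [hIL, hJL, LinearIsometry.norm_map] at h
  have hL : Function.Injective L := (injective_iff_map_eq_zero L).2 fun a ha => by
    ext i
    simpa [ha] using (h a).2 i
  have hM : ¬ FiniteDimensional ℝ (LinearMap.range L) := fun hfin => by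
    have := Module.Finite.equiv (LinearEquiv.ofInjective L hL).symm
    exact not_finite_iff_infinite.2 inferInstance (Module.Finite.finite_basis
      (Finsupp.basisSingleOne (R := ℝ) (ι := ℕ)))
  obtain ⟨_, ⟨a, rfl⟩, ha⟩ := hT _ hM K⁻¹ (inv_pos.2 hK)
  rw [inv_mul_eq_div, lt_div_iff₀ hK, mul_comm] at ha
  exact ha.not_ge (h a).1

end StrictlySingular

theorem lp.tendsto_norm_sub_lpTrunc {p : ℝ≥0∞} [Fact (1 ≤ p)] (hp : p ≠ ∞)
    (x : lp (fun _ : ℕ => ℝ) p) : Tendsto (fun N => ‖x - lpTrunc N x‖) atTop (𝓝 0) := by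
  simpa [lpTrunc] using
    ((tendsto_const_nhds (x := x)).sub (lp.hasSum_single hp x).tendsto_sum_nat).norm

/-- The inclusion of `c₀` into `ℓ_∞`. -/
noncomputable def ZeroAtInftyContinuousMap.toLpInfty :
    C₀(ℕ, ℝ) →ₗᵢ[ℝ] lp (fun _ : ℕ => ℝ) ∞ where
  toFun f := ⟨(fun k => f k : ℕ → ℝ), memℓp_infty_iff.2 ⟨‖f‖, by
    rintro _ ⟨k, rfl⟩
    exact f.toBCF.norm_coe_le_norm k⟩⟩
  map_add' f g := rfl
  map_smul' c f := rfl
  norm_map' f := by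
    refine le_antisymm (lp.norm_le_of_forall_le (norm_nonneg _) f.toBCF.norm_coe_le_norm) ?_
    exact (BoundedContinuousFunction.norm_le (f := f.toBCF) (norm_nonneg _)).2
      (lp.norm_apply_le_norm ENNReal.top_ne_zero (⟨(fun k => f k : ℕ → ℝ), _⟩ : lp (fun _ : ℕ => ℝ) ∞))

theorem ZeroAtInftyContinuousMap.tendsto_norm_toLpInfty_sub_lpTrunc (f : C₀(ℕ, ℝ)) :
    Tendsto (fun N => ‖f.toLpInfty - lpTrunc N f.toLpInfty‖) atTop (𝓝 0) := by
  have hf : Tendsto f atTop (𝓝 0) := by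
    simpa [Nat.cofinite_eq_atTop] using f.zero_at_infty'
  rw [Metric.tendsto_atTop] at hf ⊢
  intro ε hε
  obtain ⟨N, hN⟩ := hf (ε / 2) (by positivity)
  refine ⟨N, fun n hn => ?_⟩
  rw [dist_zero_right, norm_norm]
  refine (lp.norm_le_of_forall_le (half_pos hε).le fun k => ?_).trans_lt (half_lt_self hε)
  rw [lp.coeFn_sub, Pi.sub_apply, lpTrunc_apply]
  split_ifs with hk
  · rw [sub_self, norm_zero]
    exact (half_pos hε).le
  · have := hN k (by omega)
    rw [dist_zero_right] at this
    rw [sub_zero]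
    exact this.le

theorem StrictlySingular.isCompactOperator_mul_list_prod_mul {Y : Type*} [NormedAddCommGroup Y]
    [NormedSpace ℝ Y] {n : ℕ} {P : Fin n → Y →L[ℝ] Y} (hsum : ∑ i, P i = 1)
    (horth : ∀ i j, i < j → P i * P j = 0)
    (hcomp : ∀ S : Y →L[ℝ] Y, StrictlySingular S → ∀ i j, i ≤ j → IsCompactOperator (P i * S * P j))
    (L : List (Y →L[ℝ] Y)) (hL : ∀ S ∈ L, StrictlySingular S) (i j : Fin n)
    (hij : (i : ℕ) < j + L.length) : IsCompactOperator (P i * L.prod * P j) := by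
  induction L generalizing i with
  | nil =>
    rw [List.prod_nil, mul_one, horth i j (by simpa using hij)]
    exact isCompactOperator_zero
  | cons S L ih =>
    have e : P i * (S :: L).prod * P j = ∑ l, P i * S * P l * (L.prod * P j) := by
      rw [← Finset.sum_mul, ← Finset.mul_sum, hsum, List.prod_cons]
      noncomm_ring
    rw [e]
    refine (compactOperator (RingHom.id ℝ) Y Y).sum_mem fun l _ => ?_
    change IsCompactOperator (P i * S * P l * (L.prod * P j))
    rcases le_or_gt i l with h | h
    · exact (hcomp S (hL S List.mem_cons_self) i l h).comp_clm (L.prod * P j)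
    · have h' := ih (fun R hR => hL R (List.mem_cons_of_mem S hR)) l (by
        rw [List.length_cons] at hij
        have : (l : ℕ) < i := h
        omega)
      rw [mul_assoc, ← mul_assoc (P l)]
      exact h'.clm_comp (P i * S)

theorem StrictlySingular.isCompactOperator_list_prod {Y : Type*} [NormedAddCommGroup Y]
    [NormedSpace ℝ Y] {n : ℕ} {P : Fin n → Y →L[ℝ] Y} (hsum : ∑ i, P i = 1)
    (horth : ∀ i j, i < j → P i * P j = 0)
    (hcomp : ∀ S : Y →L[ℝ] Y, StrictlySingular S → ∀ i j, i ≤ j → IsCompactOperator (P i * S * P j))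
    (L : List (Y →L[ℝ] Y)) (hL : ∀ S ∈ L, StrictlySingular S) (hn : n ≤ L.length) :
    IsCompactOperator L.prod := by
  have e : L.prod = ∑ i, ∑ j, P i * L.prod * P j := by
    simp_rw [← Finset.mul_sum, hsum, mul_one, ← Finset.sum_mul, hsum, one_mul]
  rw [e]
  exact (compactOperator (RingHom.id ℝ) Y Y).sum_mem fun i _ => Submodule.sum_mem _ fun j _ =>
    isCompactOperator_mul_list_prod_mul hsum horth hcomp L hL i j (by omega)

end

/-- On `Y = ℓ_{p 1} ⊕ ⋯ ⊕ ℓ_{p m} ⊕ c₀` (max norm), where `1 ≤ p 1 < ⋯ < p m < ∞`, every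
composition of `m + 1` strictly singular operators is compact. -/
theorem isCompactOperator_comp_strictlySingular_directSum_lp_c0
    (m : ℕ) (hm : 1 ≤ m) (p : Fin m → ℝ) (hp1 : ∀ j, 1 ≤ p j) (hmono : StrictMono p)
    [∀ j, Fact (1 ≤ ENNReal.ofReal (p j))]
    (T : Fin (m + 1) →
      (((∀ j : Fin m, lp (fun _ : ℕ => ℝ) (ENNReal.ofReal (p j))) × C₀(ℕ, ℝ)) →L[ℝ]
        ((∀ j : Fin m, lp (fun _ : ℕ => ℝ) (ENNReal.ofReal (p j))) × C₀(ℕ, ℝ))))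
    (hT : ∀ i, StrictlySingular (T i)) :
    IsCompactOperator ⇑((List.ofFn T).prod) := by
  let ι (k : Fin m) : lp (fun _ : ℕ => ℝ) (ENNReal.ofReal (p k)) →L[ℝ]
      ((∀ j : Fin m, lp (fun _ : ℕ => ℝ) (ENNReal.ofReal (p j))) × C₀(ℕ, ℝ)) :=
    ContinuousLinearMap.inl ℝ _ _ ∘L ContinuousLinearMap.single ℝ
      (fun j : Fin m => lp (fun _ : ℕ => ℝ) (ENNReal.ofReal (p j))) k
  let ρ (k : Fin m) : ((∀ j : Fin m, lp (fun _ : ℕ => ℝ) (ENNReal.ofReal (p j))) × C₀(ℕ, ℝ)) →L[ℝ]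
      lp (fun _ : ℕ => ℝ) (ENNReal.ofReal (p k)) :=
    ContinuousLinearMap.proj k ∘L ContinuousLinearMap.fst ℝ _ _
  let P : Fin (m + 1) →
      (((∀ j : Fin m, lp (fun _ : ℕ => ℝ) (ENNReal.ofReal (p j))) × C₀(ℕ, ℝ)) →L[ℝ]
        ((∀ j : Fin m, lp (fun _ : ℕ => ℝ) (ENNReal.ofReal (p j))) × C₀(ℕ, ℝ))) :=
    Fin.snoc (α := fun _ => _) (fun k => ι k ∘L ρ k)
      (ContinuousLinearMap.inr ℝ _ _ ∘L ContinuousLinearMap.snd ℝ _ _)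
  have hPc (k : Fin m) : P k.castSucc = ι k ∘L ρ k := by simp [P]
  have hPl : P (Fin.last m) = ContinuousLinearMap.inr ℝ _ _ ∘L ContinuousLinearMap.snd ℝ _ _ := by
    simp [P]
  have hι (k : Fin m) (x : lp (fun _ : ℕ => ℝ) (ENNReal.ofReal (p k))) : ‖ι k x‖ = ‖x‖ := by
    simp [ι, Prod.norm_def, Pi.norm_single]
  have htail (k : Fin m) := lp.tendsto_norm_sub_lpTrunc (ENNReal.ofReal_ne_top (r := p k))
  have htail₀ := ZeroAtInftyContinuousMap.tendsto_norm_toLpInfty_sub_lpTrunc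
  refine StrictlySingular.isCompactOperator_list_prod (P := P) ?_ ?_ ?_ _ ?_ (by simp)
  · rw [Fin.sum_univ_castSucc, hPl]
    simp_rw [hPc]
    refine ContinuousLinearMap.ext fun x => Prod.ext ?_ ?_
    · simpa [ι, ρ, sum_apply, Prod.fst_sum] using Finset.univ_sum_single x.1
    · simp [ι, ρ, Prod.snd_sum]
  · intro i j hij
    induction i using Fin.lastCases with
    | last => exact absurd hij (Fin.le_last j).not_gt
    | cast i =>
      induction j using Fin.lastCases with
      | last => rw [hPc, hPl]; ext <;> simp [ρ]
      | cast j =>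
        rw [hPc, hPc]
        have : i ≠ j := by rintro rfl; exact hij.false
        ext x <;> simp [ι, ρ, this]
  · intro S hS i j hij
    induction i using Fin.lastCases with
    | last =>
      obtain rfl : j = Fin.last m := le_antisymm (Fin.le_last j) hij
      rw [hPl]
      have h := (hS.clm_comp (ContinuousLinearMap.snd ℝ _ _)).comp_isometry
        (ContinuousLinearMap.inr ℝ _ _) fun x => by simp [Prod.norm_def]
      exact ((h.isCompactOperator_of_linearIsometry_lp le_rfl
        ZeroAtInftyContinuousMap.toLpInfty ZeroAtInftyContinuousMap.toLpInfty htail₀ htail₀).comp_clm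
          (ContinuousLinearMap.snd ℝ _ _)).clm_comp (ContinuousLinearMap.inr ℝ _ _)
    | cast i =>
      rw [hPc]
      induction j using Fin.lastCases with
      | last =>
        rw [hPl]
        have h := (hS.clm_comp (ρ i)).comp_isometry (ContinuousLinearMap.inr ℝ _ _)
          fun x => by simp [Prod.norm_def]
        exact ((h.isCompactOperator_of_linearIsometry_lp le_top
          ZeroAtInftyContinuousMap.toLpInfty LinearIsometry.id htail₀ (htail i)).comp_clm
            (ContinuousLinearMap.snd ℝ _ _)).clm_comp (ι i)
      | cast j =>
        rw [hPc]
        have hij' : p i ≤ p j := hmono.monotone (Fin.castSucc_le_castSucc_iff.1 hij)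
        exact ((((hS.clm_comp (ρ i)).comp_isometry (ι j) (hι j)).isCompactOperator_of_linearIsometry_lp
          (ENNReal.ofReal_le_ofReal hij') LinearIsometry.id LinearIsometry.id
          (htail j) (htail i)).comp_clm (ρ j)).clm_comp (ι i)
  · intro S hS
    obtain ⟨i, rfl⟩ := (List.mem_ofFn' T S).1 hS
    exact hT i
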